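/- Let n ≥ 3 be an integer and let θ be a real number with 0 < θ < 1/2 and ⌊nθ⌋ ≥ 1. Then a(n) ≥ ((n − ⌊nθ⌋)² + 1)·(⌊nθ⌋ − 1)·(n − 2) + ((n − ⌊nθ⌋ − 1)² + 1)·⌊nθ⌋·(n − 2) + (n − 2⌊nθ⌋)·(n − 3) + 4n − 2⌊nθ⌋ − 2. -/

import Mathlib

/-- The grid `A_n = {(x,y) ∈ ℤ² : 1 ≤ x, y ≤ n}`. -/
def gridSet (n : ℕ) : Set (ℤ × ℤ) :=
  {p | 1 ≤ p.1 ∧ p.1 ≤ (n : ℤ) ∧ 1 ≤ p.2 ∧ p.2 ≤ (n : ℤ)}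

/-- The embedding of an integer lattice point into the real plane. -/
def toR2 (p : ℤ × ℤ) : ℝ × ℝ := ((p.1 : ℝ), (p.2 : ℝ))

/-- Squared Euclidean distance between two lattice points, as a natural number. -/
def sqLen (p q : ℤ × ℤ) : ℕ := (q.1 - p.1).natAbs ^ 2 + (q.2 - p.2).natAbs ^ 2

/-- `f : ZMod (n²) → ℤ × ℤ` is a simple closed grid polygon on `A_n`:
it is a bijection onto `A_n`, and any two distinct (closed) edges of the closed
polygonal curve `f 0, f 1, …, f (n²-1), f 0` meet only in common endpoints. -/
structure IsSimpleClosedGridPolygon (n : ℕ) (f : ZMod (n ^ 2) → ℤ × ℤ) : Prop where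
  inj : Function.Injective f
  range_eq : Set.range f = gridSet n
  simple : ∀ i j : ZMod (n ^ 2), i ≠ j →
    segment ℝ (toR2 (f i)) (toR2 (f (i + 1))) ∩
        segment ℝ (toR2 (f j)) (toR2 (f (j + 1))) ⊆
      ({toR2 (f i), toR2 (f (i + 1))} : Set (ℝ × ℝ)) ∩
        ({toR2 (f j), toR2 (f (j + 1))} : Set (ℝ × ℝ))

/-- The weight `s(f)`: sum of the squared Euclidean side lengths. -/
def polyWeight (n : ℕ) (f : ZMod (n ^ 2) → ℤ × ℤ) : ℕ :=
  ∑ i ∈ Finset.range (n ^ 2), sqLen (f (i : ZMod (n ^ 2))) (f ((i : ZMod (n ^ 2)) + 1))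

/-- `a(n)`: the maximal weight of a simple closed grid polygon on `A_n`. -/
noncomputable def polyA (n : ℕ) : ℕ :=
  sSup {w : ℕ | ∃ f, IsSimpleClosedGridPolygon n f ∧ polyWeight n f = w}

/-- A grid polygon is proper if no three consecutive vertices are collinear. -/
def IsProper (n : ℕ) (f : ZMod (n ^ 2) → ℤ × ℤ) : Prop :=
  ∀ i : ZMod (n ^ 2),
    ¬ Collinear ℝ ({toR2 (f i), toR2 (f (i + 1)), toR2 (f (i + 2))} : Set (ℝ × ℝ))

/-- `a₀(n)`: the maximal weight of a proper simple closed grid polygon on `A_n`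
(the supremum in `ℕ`, equal to `0` if no proper polygon exists). -/
noncomputable def polyA0 (n : ℕ) : ℕ :=
  sSup {w : ℕ | ∃ f, IsSimpleClosedGridPolygon n f ∧ IsProper n f ∧ polyWeight n f = w}

/-- The closed segments `PQ` and `RS` meet only in common endpoints. -/
def MeetAtEnds (P Q R S : ℤ × ℤ) : Prop :=
  segment ℝ (toR2 P) (toR2 Q) ∩ segment ℝ (toR2 R) (toR2 S) ⊆
    ({toR2 P, toR2 Q} : Set (ℝ × ℝ)) ∩ ({toR2 R, toR2 S} : Set (ℝ × ℝ))

/-- The only lattice points on the segment `PQ` are its endpoints. -/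
def PrimitiveSegment (P Q : ℤ × ℤ) : Prop :=
  ∀ Z : ℤ × ℤ, toR2 Z ∈ segment ℝ (toR2 P) (toR2 Q) → Z = P ∨ Z = Q

lemma MeetAtEnds.symm {P Q R S : ℤ × ℤ} (h : MeetAtEnds P Q R S) : MeetAtEnds R S P Q := by
  intro z hz
  exact (h hz.symm).symm

lemma MeetAtEnds.swap_left {P Q R S : ℤ × ℤ} (h : MeetAtEnds P Q R S) :
    MeetAtEnds Q P R S := by
  unfold MeetAtEnds at *
  rwa [segment_symm, Set.pair_comm]

lemma MeetAtEnds.swap_right {P Q R S : ℤ × ℤ} (h : MeetAtEnds P Q R S) :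
    MeetAtEnds P Q S R :=
  h.symm.swap_left.symm

lemma exists_of_mem_segment_toR2 {P Q : ℤ × ℤ} {z : ℝ × ℝ}
    (h : z ∈ segment ℝ (toR2 P) (toR2 Q)) :
    ∃ s t : ℝ, 0 ≤ s ∧ 0 ≤ t ∧ s + t = 1 ∧
      z.1 = s * P.1 + t * Q.1 ∧ z.2 = s * P.2 + t * Q.2 := by
  obtain ⟨s, t, hs, ht, hst, rfl⟩ := h
  exact ⟨s, t, hs, ht, hst, by simp [toR2], by simp [toR2]⟩

lemma primitiveSegment_of_linear_succ {P Q : ℤ × ℤ} (a b : ℤ)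
    (h : a * Q.1 + b * Q.2 = a * P.1 + b * P.2 + 1) : PrimitiveSegment P Q := by
  intro Z hZ
  obtain ⟨s, t, hs, ht, hst, h1, h2⟩ := exists_of_mem_segment_toR2 hZ
  obtain rfl : s = 1 - t := by linarith
  simp only [toR2] at h1 h2
  have hR : (a * Q.1 + b * Q.2 : ℝ) = a * P.1 + b * P.2 + 1 := by exact_mod_cast h
  have ht' : (t : ℝ) = ((a * Z.1 + b * Z.2 - (a * P.1 + b * P.2) : ℤ) : ℝ) := by
    push_cast
    rw [h1, h2]
    linear_combination -t * hR
  generalize a * Z.1 + b * Z.2 - (a * P.1 + b * P.2) = k at ht'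
  subst ht'
  have hk0 : 0 ≤ k := by exact_mod_cast ht
  have hk1 : k ≤ 1 := by
    have : (k : ℝ) ≤ 1 := by linarith
    exact_mod_cast this
  obtain rfl | rfl : k = 0 ∨ k = 1 := by omega
  · left
    norm_num at h1 h2
    exact Prod.ext h1 h2
  · right
    norm_num at h1 h2
    exact Prod.ext h1 h2

lemma eq_endpoint_of_linear_eq {P Q : ℤ × ℤ} {z : ℝ × ℝ} (a b c : ℤ)
    (hz : z ∈ segment ℝ (toR2 P) (toR2 Q))
    (hP : a * P.1 + b * P.2 ≤ c) (hQ : a * Q.1 + b * Q.2 ≤ c)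
    (hlt : a * P.1 + b * P.2 + (a * Q.1 + b * Q.2) < 2 * c)
    (hzc : (c : ℝ) ≤ a * z.1 + b * z.2) : z = toR2 P ∨ z = toR2 Q := by
  obtain ⟨s, t, hs, ht, hst, h1, h2⟩ := exists_of_mem_segment_toR2 hz
  obtain rfl : s = 1 - t := by linarith
  have hP' : (a * P.1 + b * P.2 : ℝ) ≤ c := by exact_mod_cast hP
  have hQ' : (a * Q.1 + b * Q.2 : ℝ) ≤ c := by exact_mod_cast hQ
  rw [h1, h2] at hzc
  have hmul1 := mul_le_mul_of_nonneg_left hP' hs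
  have hmul2 := mul_le_mul_of_nonneg_left hQ' ht
  rcases hP.lt_or_eq with hPc | hPc
  · have hPc' : (a * P.1 + b * P.2 : ℝ) < c := by exact_mod_cast hPc
    have h0 : (1 - t) * (c - (a * P.1 + b * P.2 : ℝ)) = 0 := by nlinarith
    have : 1 - t = 0 := (mul_eq_zero.1 h0).resolve_right (by linarith)
    obtain rfl : t = 1 := by linarith
    right
    ext <;> simp [toR2, h1, h2]
  · have hQc : a * Q.1 + b * Q.2 < c := by omega
    have hQc' : (a * Q.1 + b * Q.2 : ℝ) < c := by exact_mod_cast hQc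
    have h0 : t * (c - (a * Q.1 + b * Q.2 : ℝ)) = 0 := by nlinarith
    obtain rfl : t = 0 := (mul_eq_zero.1 h0).resolve_right (by linarith)
    left
    ext <;> simp [toR2, h1, h2]

lemma linear_le_of_mem_segment {P Q : ℤ × ℤ} {z : ℝ × ℝ} (a b c : ℤ)
    (hz : z ∈ segment ℝ (toR2 P) (toR2 Q))
    (hP : a * P.1 + b * P.2 ≤ c) (hQ : a * Q.1 + b * Q.2 ≤ c) :
    (a * z.1 + b * z.2 : ℝ) ≤ c := by
  obtain ⟨s, t, hs, ht, hst, h1, h2⟩ := exists_of_mem_segment_toR2 hz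
  obtain rfl : s = 1 - t := by linarith
  have hP' : (a * P.1 + b * P.2 : ℝ) ≤ c := by exact_mod_cast hP
  have hQ' : (a * Q.1 + b * Q.2 : ℝ) ≤ c := by exact_mod_cast hQ
  rw [h1, h2]
  nlinarith [mul_le_mul_of_nonneg_left hP' hs, mul_le_mul_of_nonneg_left hQ' ht]

/-- Primitive segments weakly separated by a line which does not contain both of them meet only
in common endpoints. -/
lemma meetAtEnds_of_separated {P Q R S : ℤ × ℤ} (hPQ : PrimitiveSegment P Q)
    (hRS : PrimitiveSegment R S) (a b c : ℤ)
    (hP : a * P.1 + b * P.2 ≤ c) (hQ : a * Q.1 + b * Q.2 ≤ c)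
    (hR : c ≤ a * R.1 + b * R.2) (hS : c ≤ a * S.1 + b * S.2)
    (hlt : a * P.1 + b * P.2 + (a * Q.1 + b * Q.2) < a * R.1 + b * R.2 + (a * S.1 + b * S.2)) :
    MeetAtEnds P Q R S := by
  rintro z ⟨hz1, hz2⟩
  have hR' : -a * R.1 + -b * R.2 ≤ -c := by linarith
  have hS' : -a * S.1 + -b * S.2 ≤ -c := by linarith
  have hle := linear_le_of_mem_segment a b c hz1 hP hQ
  have hge := linear_le_of_mem_segment (-a) (-b) (-c) hz2 hR' hS'
  push_cast at hge
  by_cases h : a * P.1 + b * P.2 + (a * Q.1 + b * Q.2) < 2 * c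
  · have hz := eq_endpoint_of_linear_eq a b c hz1 hP hQ h (by linarith)
    refine ⟨hz, ?_⟩
    rcases hz with rfl | rfl
    · rcases hRS _ hz2 with rfl | rfl <;> simp
    · rcases hRS _ hz2 with rfl | rfl <;> simp
  · have hz := eq_endpoint_of_linear_eq (-a) (-b) (-c) hz2 hR' hS' (by linarith)
      (by push_cast; linarith)
    refine ⟨?_, hz⟩
    rcases hz with rfl | rfl
    · rcases hPQ _ hz1 with rfl | rfl <;> simp
    · rcases hPQ _ hz1 with rfl | rfl <;> simp

/-- A long edge of the construction, joining the left and right parts of two adjacent rows. -/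
def IsZigEdge (n m : ℤ) (P Q : ℤ × ℤ) : Prop :=
  Q.2 = P.2 + 1 ∧ 2 ≤ P.1 ∧ Q.1 ≤ n ∧ 2 ≤ P.2 ∧ n - m - 1 ≤ Q.1 - P.1 ∧ Q.1 - P.1 ≤ n - m

/-- A horizontal unit edge of the construction. -/
def IsHorizEdge (n : ℤ) (P Q : ℤ × ℤ) : Prop :=
  Q.2 = P.2 ∧ Q.1 = P.1 + 1 ∧ 1 ≤ P.1 ∧ Q.1 ≤ n

/-- A vertical unit edge of the construction. -/
def IsVertEdge (n : ℤ) (P Q : ℤ × ℤ) : Prop :=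
  Q.2 = P.2 + 1 ∧ Q.1 = P.1 ∧ (P.1 = 1 ∨ P.1 = n ∧ P.2 = 1)

/-- The edges of the construction, oriented upwards or to the right. -/
def IsThetaEdge (n m : ℤ) (P Q : ℤ × ℤ) : Prop :=
  IsZigEdge n m P Q ∨ IsHorizEdge n P Q ∨ IsVertEdge n P Q

lemma IsThetaEdge.primitiveSegment {n m : ℤ} {P Q : ℤ × ℤ} (h : IsThetaEdge n m P Q) :
    PrimitiveSegment P Q := by
  rcases h with h | h | h
  · exact primitiveSegment_of_linear_succ 0 1 (by linarith [h.1])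
  · exact primitiveSegment_of_linear_succ 1 0 (by linarith [h.2.1])
  · exact primitiveSegment_of_linear_succ 0 1 (by linarith [h.1])

lemma IsThetaEdge.meetAtEnds {n m : ℤ} (hmn : 2 * m < n) (hm : 1 ≤ m) {P Q R S : ℤ × ℤ}
    (h : IsThetaEdge n m P Q) (h' : IsThetaEdge n m R S) (hne : ¬ (P = R ∧ Q = S)) :
    MeetAtEnds P Q R S := by
  have key := @meetAtEnds_of_separated P Q R S h.primitiveSegment h'.primitiveSegment
  have key' := @meetAtEnds_of_separated R S P Q h'.primitiveSegment h.primitiveSegment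
  obtain ⟨px, py⟩ := P
  obtain ⟨qx, qy⟩ := Q
  obtain ⟨rx, ry⟩ := R
  obtain ⟨sx, sy⟩ := S
  simp only [IsThetaEdge, IsZigEdge, IsHorizEdge, IsVertEdge, Prod.mk.injEq] at h h' hne key key'
  rcases h with h | h | h <;> rcases h' with h' | h' | h'
  · obtain ⟨rfl, h⟩ := h
    obtain ⟨rfl, h'⟩ := h'
    rcases lt_trichotomy py ry with hy | rfl | hy
    · apply key 0 1 (py + 1) <;> omega
    · have hcases : (px ≤ rx ∧ qx ≤ sx) ∨ (rx ≤ px ∧ sx ≤ qx) := by omega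
      rcases hcases with ⟨h1, h2⟩ | ⟨h1, h2⟩
      · have h3 : px + qx < rx + sx := by omega
        apply key 1 (-(qx - px)) (px - (qx - px) * py) <;> linarith
      · have h3 : rx + sx < px + qx := by omega
        refine (key' 1 (-(sx - rx)) (rx - (sx - rx) * py) ?_ ?_ ?_ ?_ ?_).symm <;> linarith
    · refine (key' 0 1 (ry + 1) ?_ ?_ ?_ ?_ ?_).symm <;> omega
  · rcases le_or_gt ry py with hy | hy
    · refine (key' 0 1 py ?_ ?_ ?_ ?_ ?_).symm <;> omega
    · apply key 0 1 (py + 1) <;> omega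
  · rcases h'.2.2 with hx | hx
    · refine (key' 1 0 1 ?_ ?_ ?_ ?_ ?_).symm <;> omega
    · refine (key' 0 1 2 ?_ ?_ ?_ ?_ ?_).symm <;> omega
  · rcases le_or_gt py ry with hy | hy
    · apply key 0 1 ry <;> omega
    · refine (key' 0 1 (ry + 1) ?_ ?_ ?_ ?_ ?_).symm <;> omega
  · rcases lt_trichotomy py ry with hy | rfl | hy
    · apply key 0 1 py <;> omega
    · rcases lt_or_ge px rx with hx | hx
      · apply key 1 0 rx <;> omega
      · refine (key' 1 0 px ?_ ?_ ?_ ?_ ?_).symm <;> omega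
    · refine (key' 0 1 ry ?_ ?_ ?_ ?_ ?_).symm <;> omega
  · rcases h'.2.2 with hx | hx
    · refine (key' 1 0 1 ?_ ?_ ?_ ?_ ?_).symm <;> omega
    · apply key 1 0 n <;> omega
  · rcases h.2.2 with hx | hx
    · apply key 1 0 1 <;> omega
    · apply key 0 1 2 <;> omega
  · rcases h.2.2 with hx | hx
    · apply key 1 0 1 <;> omega
    · refine (key' 1 0 n ?_ ?_ ?_ ?_ ?_).symm <;> omega
  · rcases lt_trichotomy px rx with hx | rfl | hx
    · apply key 1 0 px <;> omega
    · rcases lt_or_ge py ry with hy | hy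
      · apply key 0 1 ry <;> omega
      · refine (key' 0 1 py ?_ ?_ ?_ ?_ ?_).symm <;> omega
    · refine (key' 1 0 rx ?_ ?_ ?_ ?_ ?_).symm <;> omega

/-- The `r`-th vertex of the `q`-th zig-zag of the construction, counted from the top. -/
def thetaBlock (n m q r : ℕ) : ℤ × ℤ :=
  if r < 2 * m then
    if r % 2 = 0 then ((n : ℤ) - m + 1 + (r / 2 : ℕ), (n : ℤ) - q)
    else (2 + (r / 2 : ℕ), (n : ℤ) - 1 - q)
  else ((r : ℤ) - m + 2, (n : ℤ) - 1 - q)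

/-- The part of the construction returning from the last zig-zag to the first one. -/
def thetaTail (n m k : ℕ) : ℤ × ℤ :=
  if k < m then ((n : ℤ) - m + 1 + k, 2)
  else if k < m + n then ((n : ℤ) - (k - m), 1)
  else if k < m + 2 * n - 1 then (1, (k : ℤ) - m - n + 2)
  else ((k : ℤ) - m - 2 * n + 3, n)

/-- The vertices of the construction. -/
def thetaVertex (n m k : ℕ) : ℤ × ℤ :=
  if k < (n - 1) * (n - 2) then thetaBlock n m (k / (n - 1)) (k % (n - 1))
  else thetaTail n m (k - (n - 1) * (n - 2))

section Construction

variable {n m : ℕ}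

lemma thetaVertex_tail (k : ℕ) : thetaVertex n m ((n - 1) * (n - 2) + k) = thetaTail n m k := by
  simp [thetaVertex]

lemma thetaVertex_block_of_lt {q r : ℕ} (hq : q < n - 2) (hr : r < n - 1) :
    thetaVertex n m ((n - 1) * q + r) = thetaBlock n m q r := by
  have hlt : (n - 1) * q + r < (n - 1) * (n - 2) := by
    calc (n - 1) * q + r < (n - 1) * (q + 1) := by rw [mul_add]; omega
      _ ≤ _ := Nat.mul_le_mul_left _ hq
  rw [thetaVertex, if_pos hlt, Nat.mul_add_div (by omega), Nat.mul_add_mod,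
    Nat.div_eq_of_lt hr, Nat.mod_eq_of_lt hr, add_zero]

lemma thetaVertex_block (hm : 1 ≤ m) (hmn : 2 * m < n) {q r : ℕ} (hq : q < n - 2)
    (hr : r ≤ n - 1) : thetaVertex n m ((n - 1) * q + r) = thetaBlock n m q r := by
  rcases hr.lt_or_eq with hr | rfl
  · exact thetaVertex_block_of_lt hq hr
  · rw [← mul_add_one]
    have hend : thetaBlock n m q (n - 1) = ((n : ℤ) - m + 1, (n : ℤ) - 1 - q) := by
      rw [thetaBlock, if_neg (by omega)]
      ext <;> omega
    rw [hend]
    rcases Nat.lt_or_ge (q + 1) (n - 2) with h | h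
    · rw [← add_zero ((n - 1) * (q + 1)), thetaVertex_block_of_lt h (by omega), thetaBlock,
        if_pos (by omega), if_pos (by omega)]
      ext <;> simp only <;> omega
    · obtain h : q + 1 = n - 2 := by omega
      rw [h, ← add_zero ((n - 1) * (n - 2)), thetaVertex_tail, thetaTail, if_pos (by omega)]
      ext <;> simp only <;> omega

lemma sq_eq_blocks_add_tail (hn : 3 ≤ n) : n ^ 2 = (n - 1) * (n - 2) + (3 * n - 2) := by
  obtain ⟨k, rfl⟩ := Nat.exists_eq_add_of_le hn
  rw [show 3 + k - 1 = k + 2 by omega, show 3 + k - 2 = k + 1 by omega,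
    show 3 * (3 + k) - 2 = 3 * k + 7 by omega]
  ring

lemma exists_block_or_tail (hn : 3 ≤ n) {k : ℕ} (hk : k < n ^ 2) :
    (∃ q r, q < n - 2 ∧ r < n - 1 ∧ k = (n - 1) * q + r) ∨
      ∃ j, j < 3 * n - 2 ∧ k = (n - 1) * (n - 2) + j := by
  rcases lt_or_ge k ((n - 1) * (n - 2)) with h | h
  · exact Or.inl ⟨k / (n - 1), k % (n - 1), Nat.div_lt_of_lt_mul h, Nat.mod_lt _ (by omega),
      (Nat.div_add_mod _ _).symm⟩
  · refine Or.inr ⟨k - (n - 1) * (n - 2), ?_, by omega⟩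
    have := sq_eq_blocks_add_tail hn
    omega

lemma thetaVertex_sq (hm : 1 ≤ m) (hmn : 2 * m < n) :
    thetaVertex n m (n ^ 2) = thetaVertex n m 0 := by
  have h0 := thetaVertex_block hm hmn (q := 0) (r := 0) (by omega) (by omega)
  simp only [mul_zero, add_zero] at h0
  rw [h0, sq_eq_blocks_add_tail (by omega), thetaVertex_tail]
  simp only [thetaTail, thetaBlock]
  grind

lemma thetaBlock_edge (hm : 1 ≤ m) (hmn : 2 * m < n) {q r : ℕ} (hq : q < n - 2) (hr : r < n - 1) :
    IsThetaEdge n m (thetaBlock n m q r) (thetaBlock n m q (r + 1)) ∨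
      IsThetaEdge n m (thetaBlock n m q (r + 1)) (thetaBlock n m q r) := by
  rcases lt_or_ge (r + 1) (2 * m) with h | h
  · rw [thetaBlock, if_pos (by omega), thetaBlock, if_pos h]
    rcases Nat.mod_two_eq_zero_or_one r with h2 | h2
    · rw [if_pos h2, if_neg (by omega)]
      refine Or.inr (Or.inl ?_)
      simp only [IsZigEdge]
      refine ⟨?_, ?_, ?_, ?_, ?_, ?_⟩ <;> omega
    · rw [if_neg (by omega), if_pos (by omega)]
      refine Or.inl (Or.inl ?_)
      simp only [IsZigEdge]
      refine ⟨?_, ?_, ?_, ?_, ?_, ?_⟩ <;> omega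
  · refine Or.inl (Or.inr (Or.inl ?_))
    simp only [IsHorizEdge, thetaBlock]
    rcases h.lt_or_eq with h2 | h2
    · rw [if_neg (by omega), if_neg (by omega)]
      refine ⟨?_, ?_, ?_, ?_⟩ <;> simp only <;> omega
    · rw [if_pos (show r < 2 * m by omega), if_neg (show ¬ r % 2 = 0 by omega),
        if_neg (show ¬ r + 1 < 2 * m by omega)]
      refine ⟨?_, ?_, ?_, ?_⟩ <;> simp only <;> omega

lemma thetaTail_edge (hm : 1 ≤ m) (hmn : 2 * m < n) {k : ℕ} (hk : k < 3 * n - 2) :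
    IsThetaEdge n m (thetaTail n m k) (thetaTail n m (k + 1)) ∨
      IsThetaEdge n m (thetaTail n m (k + 1)) (thetaTail n m k) := by
  have horiz : k + 1 < m ∨ m + 2 * n - 2 ≤ k →
      IsHorizEdge n (thetaTail n m k) (thetaTail n m (k + 1)) := by
    intro h
    simp only [thetaTail]
    split_ifs <;> refine ⟨?_, ?_, ?_, ?_⟩ <;> simp only <;> omega
  have horiz_left : m ≤ k → k + 1 < m + n →
      IsHorizEdge n (thetaTail n m (k + 1)) (thetaTail n m k) := by
    intro h1 h2
    rw [thetaTail, if_neg (by omega), if_pos (by omega), thetaTail, if_neg (by omega),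
      if_pos (by omega)]
    refine ⟨?_, ?_, ?_, ?_⟩ <;> simp only <;> omega
  have vert : m + n ≤ k + 1 → k < m + 2 * n - 2 →
      IsVertEdge n (thetaTail n m k) (thetaTail n m (k + 1)) := by
    intro h1 h2
    simp only [thetaTail]
    split_ifs <;> refine ⟨?_, ?_, Or.inl ?_⟩ <;> simp only <;> omega
  have vert_down : k + 1 = m → IsVertEdge n (thetaTail n m (k + 1)) (thetaTail n m k) := by
    intro h
    rw [thetaTail, if_neg (by omega), if_pos (by omega), thetaTail, if_pos (by omega)]
    refine ⟨?_, ?_, Or.inr ⟨?_, ?_⟩⟩ <;> simp only <;> omega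
  have cases : (k + 1 < m ∨ m + 2 * n - 2 ≤ k) ∨ (m ≤ k ∧ k + 1 < m + n) ∨
      (m + n ≤ k + 1 ∧ k < m + 2 * n - 2) ∨ k + 1 = m := by omega
  rcases cases with h | h | h | h
  · exact Or.inl (Or.inr (Or.inl (horiz h)))
  · exact Or.inr (Or.inr (Or.inl (horiz_left h.1 h.2)))
  · exact Or.inl (Or.inr (Or.inr (vert h.1 h.2)))
  · exact Or.inr (Or.inr (Or.inr (vert_down h)))

lemma thetaVertex_edge (hm : 1 ≤ m) (hmn : 2 * m < n) {k : ℕ} (hk : k < n ^ 2) :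
    IsThetaEdge n m (thetaVertex n m k) (thetaVertex n m (k + 1)) ∨
      IsThetaEdge n m (thetaVertex n m (k + 1)) (thetaVertex n m k) := by
  rcases exists_block_or_tail (by omega) hk with ⟨q, r, hq, hr, rfl⟩ | ⟨j, hj, rfl⟩
  · rw [add_assoc, thetaVertex_block hm hmn hq hr.le, thetaVertex_block hm hmn hq hr]
    exact thetaBlock_edge hm hmn hq hr
  · rw [add_assoc, thetaVertex_tail, thetaVertex_tail]
    exact thetaTail_edge hm hmn hj

lemma thetaVertex_mem_gridSet (hmn : 2 * m < n) (hm : 1 ≤ m) {k : ℕ} (hk : k < n ^ 2) :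
    thetaVertex n m k ∈ gridSet n := by
  rcases exists_block_or_tail (by omega) hk with ⟨q, r, hq, hr, rfl⟩ | ⟨j, hj, rfl⟩
  · rw [thetaVertex_block hm hmn hq hr.le]
    simp only [thetaBlock, gridSet, Set.mem_ofPred_eq]
    split_ifs <;> simp only <;> omega
  · rw [thetaVertex_tail]
    simp only [thetaTail, gridSet, Set.mem_ofPred_eq]
    split_ifs <;> simp only <;> omega

lemma exists_thetaVertex_eq (hm : 1 ≤ m) (hmn : 2 * m < n) {p : ℤ × ℤ} (hp : p ∈ gridSet n) :
    ∃ k < n ^ 2, thetaVertex n m k = p := by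
  have hsq := sq_eq_blocks_add_tail (n := n) (by omega)
  have block : ∀ q r, q < n - 2 → r < n - 1 → thetaBlock n m q r = p →
      ∃ k < n ^ 2, thetaVertex n m k = p := by
    intro q r hq hr h
    refine ⟨(n - 1) * q + r, ?_, by rw [thetaVertex_block hm hmn hq hr.le, h]⟩
    have : (n - 1) * (q + 1) ≤ (n - 1) * (n - 2) := Nat.mul_le_mul_left _ hq
    rw [mul_add] at this
    omega
  have tail : ∀ j, j < 3 * n - 2 → thetaTail n m j = p →
      ∃ k < n ^ 2, thetaVertex n m k = p := by
    intro j hj h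
    exact ⟨(n - 1) * (n - 2) + j, by omega, by rw [thetaVertex_tail, h]⟩
  obtain ⟨x, y⟩ := p
  simp only [gridSet, Set.mem_ofPred_eq] at hp
  obtain ⟨hx1, hxn, hy1, hyn⟩ := hp
  lift x to ℕ using by omega
  lift y to ℕ using by omega
  by_cases h1 : y = 1
  · apply tail (m + (n - x)) (by omega)
    simp only [thetaTail]
    split_ifs <;> simp only [Prod.mk.injEq] <;> omega
  by_cases h2 : x = 1
  · apply tail (m + n + y - 2) (by omega)
    simp only [thetaTail]
    split_ifs <;> simp only [Prod.mk.injEq] <;> omega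
  by_cases h3 : y = n ∧ x ≤ n - m
  · apply tail (x + m + 2 * n - 3) (by omega)
    simp only [thetaTail]
    split_ifs <;> simp only [Prod.mk.injEq] <;> omega
  by_cases h4 : y = 2 ∧ n - m < x
  · apply tail (x - (n - m + 1)) (by omega)
    simp only [thetaTail]
    split_ifs <;> simp only [Prod.mk.injEq] <;> omega
  by_cases h5 : x ≤ m + 1
  · apply block (n - 1 - y) (2 * (x - 2) + 1) (by omega) (by omega)
    simp only [thetaBlock]
    split_ifs <;> simp only [Prod.mk.injEq] <;> omega
  by_cases h6 : x ≤ n - m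
  · apply block (n - 1 - y) (x + m - 2) (by omega) (by omega)
    simp only [thetaBlock]
    split_ifs <;> simp only [Prod.mk.injEq] <;> omega
  · apply block (n - y) (2 * (x - (n - m + 1))) (by omega) (by omega)
    simp only [thetaBlock]
    split_ifs <;> simp only [Prod.mk.injEq] <;> omega

lemma gridSet_eq_coe_finset (n : ℕ) :
    gridSet n = ((Finset.Icc (1 : ℤ) n ×ˢ Finset.Icc (1 : ℤ) n : Finset (ℤ × ℤ)) :
      Set (ℤ × ℤ)) := by
  ext p
  simp only [gridSet, Set.mem_ofPred_eq, Finset.coe_product, Finset.coe_Icc, Set.mem_prod,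
    Set.mem_Icc, and_assoc]

/-- The polygon of the construction. -/
def thetaPolygon (n m : ℕ) (i : ZMod (n ^ 2)) : ℤ × ℤ := thetaVertex n m i.val

lemma thetaPolygon_add_one (hm : 1 ≤ m) (hmn : 2 * m < n) (i : ZMod (n ^ 2)) :
    thetaPolygon n m (i + 1) = thetaVertex n m (i.val + 1) := by
  have : NeZero (n ^ 2) := ⟨pow_ne_zero 2 (by omega)⟩
  have : Fact (1 < n ^ 2) := ⟨by nlinarith⟩
  rw [thetaPolygon, ZMod.val_add, ZMod.val_one]
  rcases (Nat.succ_le_of_lt i.val_lt).lt_or_eq with h | h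
  · rw [Nat.mod_eq_of_lt h]
  · rw [Nat.succ_eq_add_one] at h
    rw [h, Nat.mod_self, thetaVertex_sq hm hmn]

lemma thetaPolygon_natCast {k : ℕ} (hk : k < n ^ 2) :
    thetaPolygon n m k = thetaVertex n m k := by
  rw [thetaPolygon, ZMod.val_natCast, Nat.mod_eq_of_lt hk]

lemma range_thetaPolygon (hm : 1 ≤ m) (hmn : 2 * m < n) :
    Set.range (thetaPolygon n m) = gridSet n := by
  have : NeZero (n ^ 2) := ⟨pow_ne_zero 2 (by omega)⟩
  ext p
  constructor
  · rintro ⟨i, rfl⟩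
    exact thetaVertex_mem_gridSet hmn hm i.val_lt
  · intro hp
    obtain ⟨k, hk, rfl⟩ := exists_thetaVertex_eq hm hmn hp
    exact ⟨k, thetaPolygon_natCast hk⟩

lemma thetaPolygon_injective (hm : 1 ≤ m) (hmn : 2 * m < n) :
    Function.Injective (thetaPolygon n m) := by
  have : NeZero (n ^ 2) := ⟨pow_ne_zero 2 (by omega)⟩
  rw [← Set.injOn_univ, ← Finset.coe_univ, ← Finset.card_image_iff,
    ← Set.ncard_coe_finset, Finset.coe_image, Finset.coe_univ, Set.image_univ,
    range_thetaPolygon hm hmn, gridSet_eq_coe_finset, Set.ncard_coe_finset]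
  simp [ZMod.card, sq]

lemma isSimpleClosedGridPolygon_thetaPolygon (hm : 1 ≤ m) (hmn : 2 * m < n) :
    IsSimpleClosedGridPolygon n (thetaPolygon n m) where
  inj := thetaPolygon_injective hm hmn
  range_eq := range_thetaPolygon hm hmn
  simple := by
    have : NeZero (n ^ 2) := ⟨pow_ne_zero 2 (by omega)⟩
    have hinj := thetaPolygon_injective hm hmn
    have hmn' : 2 * (m : ℤ) < n := by exact_mod_cast hmn
    have hm' : 1 ≤ (m : ℤ) := by exact_mod_cast hm
    have two_ne : (2 : ZMod (n ^ 2)) ≠ 0 := by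
      intro h
      have := (ZMod.natCast_eq_zero_iff 2 (n ^ 2)).1 (by exact_mod_cast h)
      have := Nat.le_of_dvd (by norm_num) this
      nlinarith
    have edge : ∀ i : ZMod (n ^ 2),
        IsThetaEdge n m (thetaPolygon n m i) (thetaPolygon n m (i + 1)) ∨
        IsThetaEdge n m (thetaPolygon n m (i + 1)) (thetaPolygon n m i) := by
      intro i
      rw [thetaPolygon_add_one hm hmn]
      exact thetaVertex_edge hm hmn i.val_lt
    intro i j hij
    change MeetAtEnds _ _ _ _
    have hcross : ¬ (i = j + 1 ∧ i + 1 = j) := by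
      rintro ⟨rfl, h⟩
      exact two_ne (by linear_combination h)
    rcases edge i with hi | hi <;> rcases edge j with hj | hj
    · exact hi.meetAtEnds hmn' hm' hj fun h => hij (hinj h.1)
    · exact (hi.meetAtEnds hmn' hm' hj fun h => hcross ⟨hinj h.1, hinj h.2⟩).swap_right
    · exact (hi.meetAtEnds hmn' hm' hj fun h => hcross ⟨hinj h.2, hinj h.1⟩).swap_left
    · exact (hi.meetAtEnds hmn' hm' hj fun h => hij (hinj h.2)).swap_left.swap_right

lemma sqLen_thetaBlock_zig {q r : ℕ} (hr : r + 1 < 2 * m) :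
    (sqLen (thetaBlock n m q r) (thetaBlock n m q (r + 1)) : ℤ) =
      if r % 2 = 0 then ((n : ℤ) - m - 1) ^ 2 + 1 else ((n : ℤ) - m) ^ 2 + 1 := by
  simp only [sqLen, thetaBlock, Nat.cast_add, Nat.cast_pow, Int.natCast_natAbs, sq_abs]
  rw [if_pos (show r < 2 * m by omega), if_pos hr]
  rcases Nat.mod_two_eq_zero_or_one r with h | h
  · rw [if_pos h, if_neg (by omega), if_pos h, show (r + 1) / 2 = r / 2 by omega]
    ring
  · rw [if_neg (show ¬ r % 2 = 0 by omega), if_pos (show (r + 1) % 2 = 0 by omega),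
      if_neg (show ¬ r % 2 = 0 by omega), show (r + 1) / 2 = r / 2 + 1 by omega]
    push_cast
    ring

lemma one_le_sqLen {P Q : ℤ × ℤ} (h : P ≠ Q) : 1 ≤ sqLen P Q := by
  by_contra! h0
  apply h
  have h1 : sqLen P Q = 0 := by omega
  simp only [sqLen, Nat.add_eq_zero_iff, pow_eq_zero_iff two_ne_zero, Int.natAbs_eq_zero] at h1
  ext <;> omega

lemma IsThetaEdge.ne {n m : ℤ} {P Q : ℤ × ℤ} (h : IsThetaEdge n m P Q) : P ≠ Q := by
  rintro rfl
  simp only [IsThetaEdge, IsZigEdge, IsHorizEdge, IsVertEdge] at h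
  omega

lemma sum_range_parity (a b : ℤ) (k : ℕ) :
    ∑ r ∈ Finset.range (2 * k + 1), (if r % 2 = 0 then a else b) = (k + 1) * a + k * b := by
  induction k with
  | zero => simp
  | succ k ih =>
    rw [show 2 * (k + 1) + 1 = 2 * k + 1 + 1 + 1 by ring, Finset.sum_range_succ,
      Finset.sum_range_succ, ih, if_neg (by omega), if_pos (by omega)]
    push_cast
    ring

lemma sum_range_mul_blocks {M : Type*} [AddCommMonoid M] (g : ℕ → M) (a b : ℕ) :
    ∑ k ∈ Finset.range (a * b), g k =
      ∑ q ∈ Finset.range b, ∑ r ∈ Finset.range a, g (a * q + r) := by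
  induction b with
  | zero => simp
  | succ b ih => rw [mul_add_one, Finset.sum_range_add, ih, Finset.sum_range_succ]

lemma block_weight_le (hm : 1 ≤ m) (hmn : 2 * m < n) {q : ℕ} (hq : q < n - 2) :
    (((n : ℤ) - m - 1) ^ 2 + 1) * m + (((n : ℤ) - m) ^ 2 + 1) * (m - 1) + (n - 2 * m) ≤
      ∑ r ∈ Finset.range (n - 1),
        (sqLen (thetaBlock n m q r) (thetaBlock n m q (r + 1)) : ℤ) := by
  obtain ⟨k, rfl⟩ := Nat.exists_eq_add_of_le' hm
  rw [show n - 1 = 2 * k + 1 + (n - 2 * (k + 1)) by omega, Finset.sum_range_add,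
    Finset.sum_congr rfl fun r hr =>
      sqLen_thetaBlock_zig (by have := Finset.mem_range.1 hr; omega), sum_range_parity]
  have hrest : ((n - 2 * (k + 1) : ℕ) : ℤ) ≤ ∑ x ∈ Finset.range (n - 2 * (k + 1)),
      (sqLen (thetaBlock n (k + 1) q (2 * k + 1 + x))
        (thetaBlock n (k + 1) q (2 * k + 1 + x + 1)) : ℤ) := by
    calc ((n - 2 * (k + 1) : ℕ) : ℤ) = ∑ x ∈ Finset.range (n - 2 * (k + 1)), 1 := by simp
      _ ≤ _ := Finset.sum_le_sum fun x hx => by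
        have hx := Finset.mem_range.1 hx
        have := thetaBlock_edge hm hmn hq (r := 2 * k + 1 + x) (by omega)
        exact_mod_cast one_le_sqLen (this.elim IsThetaEdge.ne fun h => h.ne.symm)
  rw [Nat.cast_sub (by omega)] at hrest
  push_cast at hrest ⊢
  linarith

lemma le_polyWeight_thetaPolygon (hm : 1 ≤ m) (hmn : 2 * m < n) :
    ((n : ℤ) - 2) * ((((n : ℤ) - m - 1) ^ 2 + 1) * m + (((n : ℤ) - m) ^ 2 + 1) * (m - 1)
      + (n - 2 * m)) + (3 * n - 2) ≤ (polyWeight n (thetaPolygon n m) : ℤ) := by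
  have : NeZero (n ^ 2) := ⟨pow_ne_zero 2 (by omega)⟩
  have hw : polyWeight n (thetaPolygon n m) =
      ∑ k ∈ Finset.range (n ^ 2), sqLen (thetaVertex n m k) (thetaVertex n m (k + 1)) := by
    refine Finset.sum_congr rfl fun k hk => ?_
    have hk := Finset.mem_range.1 hk
    rw [thetaPolygon_add_one hm hmn, thetaPolygon_natCast hk, ZMod.val_natCast,
      Nat.mod_eq_of_lt hk]
  rw [hw, sq_eq_blocks_add_tail (by omega), Finset.sum_range_add, sum_range_mul_blocks]
  push_cast
  refine add_le_add ?_ ?_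
  · calc _ = ∑ q ∈ Finset.range (n - 2), ((((n : ℤ) - m - 1) ^ 2 + 1) * m
          + (((n : ℤ) - m) ^ 2 + 1) * (m - 1) + (n - 2 * m)) := by
          rw [Finset.sum_const, Finset.card_range, nsmul_eq_mul, Nat.cast_sub (by omega)]
          push_cast
          rfl
      _ ≤ _ := Finset.sum_le_sum fun q hq => by
        have hq := Finset.mem_range.1 hq
        refine (block_weight_le hm hmn hq).trans_eq (Finset.sum_congr rfl fun r hr => ?_)
        have hr := Finset.mem_range.1 hr
        rw [add_assoc, thetaVertex_block hm hmn hq hr.le, thetaVertex_block hm hmn hq hr]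
  · calc (3 * n - 2 : ℤ) = ∑ j ∈ Finset.range (3 * n - 2), 1 := by
          rw [Finset.sum_const, Finset.card_range, nsmul_eq_mul, Nat.cast_sub (by omega)]
          push_cast
          ring
      _ ≤ _ := Finset.sum_le_sum fun j hj => by
        have hj := Finset.mem_range.1 hj
        rw [add_assoc, thetaVertex_tail, thetaVertex_tail]
        have := thetaTail_edge hm hmn hj
        exact_mod_cast one_le_sqLen (this.elim IsThetaEdge.ne fun h => h.ne.symm)

end Construction

lemma polyWeight_le_polyA {n : ℕ} {f : ZMod (n ^ 2) → ℤ × ℤ}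
    (hf : IsSimpleClosedGridPolygon n f) : polyWeight n f ≤ polyA n := by
  refine le_csSup ⟨n ^ 2 * (n ^ 2 + n ^ 2), ?_⟩ ⟨f, hf, rfl⟩
  rintro w ⟨g, hg, rfl⟩
  have hmem : ∀ i, g i ∈ gridSet n := fun i => hg.range_eq ▸ Set.mem_range_self i
  refine (Finset.sum_le_card_nsmul _ _ (n ^ 2 + n ^ 2) fun i _ => ?_).trans_eq (by simp)
  obtain ⟨h1, h2, h3, h4⟩ := hmem (i : ZMod (n ^ 2))
  obtain ⟨h5, h6, h7, h8⟩ := hmem ((i : ZMod (n ^ 2)) + 1)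
  exact add_le_add (Nat.pow_le_pow_left (by omega) 2) (Nat.pow_le_pow_left (by omega) 2)

/-- The first construction: for `n ≥ 3` and `0 < θ < 1/2` with `⌊nθ⌋ ≥ 1`,
`a(n)` is at least the explicit weight of the zig-zag polygon built from `θ`. -/
theorem polyA_ge_theta_construction (n : ℕ) (hn : 3 ≤ n) (θ : ℝ)
    (hθ0 : 0 < θ) (hθ1 : θ < 1 / 2) (hfloor : 1 ≤ ⌊(n : ℝ) * θ⌋) :
    (((n : ℤ) - ⌊(n : ℝ) * θ⌋) ^ 2 + 1) * (⌊(n : ℝ) * θ⌋ - 1) * ((n : ℤ) - 2)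
      + (((n : ℤ) - ⌊(n : ℝ) * θ⌋ - 1) ^ 2 + 1) * ⌊(n : ℝ) * θ⌋ * ((n : ℤ) - 2)
      + ((n : ℤ) - 2 * ⌊(n : ℝ) * θ⌋) * ((n : ℤ) - 3)
      + 4 * (n : ℤ) - 2 * ⌊(n : ℝ) * θ⌋ - 2 ≤ (polyA n : ℤ) := by
  have hn0 : (0 : ℝ) < n := by exact_mod_cast (by omega : 0 < n)
  generalize hM : ⌊(n : ℝ) * θ⌋ = M at hfloor ⊢
  have hMn : 2 * M < n := by
    have h1 : (M : ℝ) ≤ n * θ := hM ▸ Int.floor_le _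
    have h2 : (2 * M : ℝ) < n := by nlinarith
    exact_mod_cast h2
  lift M to ℕ using by omega
  have hm : 1 ≤ M := by exact_mod_cast hfloor
  have hmn : 2 * M < n := by exact_mod_cast hMn
  have h1 := le_polyWeight_thetaPolygon hm hmn
  have h2 : (polyWeight n (thetaPolygon n M) : ℤ) ≤ polyA n := by
    exact_mod_cast polyWeight_le_polyA (isSimpleClosedGridPolygon_thetaPolygon hm hmn)
  refine le_trans (le_of_eq ?_) (h1.trans h2)
  ring
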